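/- arXiv:1902.00992 — 2 statements merged into one kernel-verified Lean document; each statement's English description precedes it below -/
import Mathlib

section
/- Let (Ω,Σ,P) be a probability space, let K be a convex set of random variables that is bounded in L^1(P), and let S be a nonempty subset of K. The following are equivalent: (1) the relative L^0(P)-topology on K is uniformly locally convex-solid on S; (2) there exists a probability measure Q equivalent to P such that whenever a sequence (X_n) in K converges in P-probability to some X ∈ S, then E_Q[|X_n − X|] → 0. -/
open MeasureTheory Filter Set ProbabilityTheory

noncomputable section

namespace Paper

variable {Ω : Type*} [MeasurableSpace Ω]

/-- The metric `d(X,Y) = E_P[min(|X - Y|, 1)]` metrizing convergence in `P`-probability. -/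
def probDist (P : Measure Ω) (X Y : Ω → ℝ) : ℝ :=
  ∫ ω, min |X ω - Y ω| 1 ∂P

/-- `Q` is a probability measure equivalent to `P` (mutually absolutely continuous). -/
def EquivProb (P Q : Measure Ω) : Prop :=
  IsProbabilityMeasure Q ∧ Q ≪ P ∧ P ≪ Q

/-- `K` is a set of `P`-integrable random variables bounded in `L¹(P)`. -/
def BddL1 (P : Measure Ω) (K : Set (Ω → ℝ)) : Prop :=
  (∀ X ∈ K, Integrable X P) ∧ ∃ C : ℝ, ∀ X ∈ K, (∫ ω, |X ω| ∂P) ≤ C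

/-- `K` is `Q`-uniformly integrable: all members are `Q`-integrable and
`sup_{X ∈ K} E_Q[|X| · 1_{|X| > c}] → 0` as `c → ∞`. -/
def UIset (Q : Measure Ω) (K : Set (Ω → ℝ)) : Prop :=
  (∀ X ∈ K, Integrable X Q) ∧
  ∀ ε : ℝ, 0 < ε → ∃ c : ℝ, ∀ X ∈ K, (∫ ω in {ω | c < |X ω|}, |X ω| ∂Q) < ε

/-- The sequence `Xs` is Cauchy in `P`-probability. -/
def CauchyInProb (P : Measure Ω) (Xs : ℕ → Ω → ℝ) : Prop :=
  ∀ ε : ℝ, 0 < ε →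
    Tendsto (fun p : ℕ × ℕ => P {ω | ε ≤ |Xs p.1 ω - Xs p.2 ω|}) atTop (nhds 0)

/-- The (sequential) closure of `K` in the topology of convergence in `P`-probability. -/
def probClosure (P : Measure Ω) (K : Set (Ω → ℝ)) : Set (Ω → ℝ) :=
  {X | ∃ Xs : ℕ → Ω → ℝ, (∀ n, Xs n ∈ K) ∧ TendstoInMeasure P Xs atTop X}

/-- A set `W` of random variables is solid: if `X ∈ W` and `|Y| ≤ |X|` a.s. then `Y ∈ W`. -/
def SolidSet (P : Measure Ω) (W : Set (Ω → ℝ)) : Prop :=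
  ∀ X ∈ W, ∀ Y : Ω → ℝ, AEStronglyMeasurable Y P →
    (∀ᵐ ω ∂P, |Y ω| ≤ |X ω|) → Y ∈ W

/-- The solid hull of a set `A` of random variables. -/
def solidHull (P : Measure Ω) (A : Set (Ω → ℝ)) : Set (Ω → ℝ) :=
  {Y | AEStronglyMeasurable Y P ∧ ∃ X ∈ A, ∀ᵐ ω ∂P, |Y ω| ≤ |X ω|}

/-- The relative `L⁰(P)`-topology on `K` is uniformly locally convex-solid on `S`:
for every `ε > 0` there is a convex solid set `W` of integrable random variables contained in the
`ε`-ball around `0` such that, for each `X ∈ S`, `(X + W) ∩ K` contains a `d`-ball of `K`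
around `X`. -/
def UnifLCS (P : Measure Ω) (K S : Set (Ω → ℝ)) : Prop :=
  ∀ ε : ℝ, 0 < ε → ∃ W : Set (Ω → ℝ),
    (∀ Z ∈ W, Integrable Z P) ∧ Convex ℝ W ∧ SolidSet P W ∧
    (∀ Z ∈ W, probDist P Z 0 < ε) ∧
    ∀ X ∈ S, ∃ δ : ℝ, 0 < δ ∧ ∀ Z ∈ K, probDist P Z X < δ → Z - X ∈ W

/-- The `L⁰(Q)`- and `L¹(Q)`-topologies agree on `K`: a sequence in `K` converges in
`P`-probability to a member of `K` iff it converges in `L¹(Q)`-norm. -/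
def TopAgree (P Q : Measure Ω) (K : Set (Ω → ℝ)) : Prop :=
  ∀ (Xs : ℕ → Ω → ℝ) (X : Ω → ℝ), (∀ n, Xs n ∈ K) → X ∈ K →
    (TendstoInMeasure P Xs atTop X ↔
      Tendsto (fun n => ∫⁻ ω, ENNReal.ofReal |Xs n ω - X ω| ∂Q) atTop (nhds 0))

/-- `W` is a forward convex combination of the sequence `Z`. -/
def IsFCC (Z : ℕ → Ω → ℝ) (W : ℕ → Ω → ℝ) : Prop :=
  ∀ k, W k ∈ convexHull ℝ (Z '' {n | k ≤ n})

/-- The relative `L⁰(P)`-topology on `K` is locally convex at `X` (forward convex combination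
formulation): every FCC of a sequence in `K` converging to `X` in probability also converges
to `X` in probability. -/
def LocConvexAt (P : Measure Ω) (K : Set (Ω → ℝ)) (X : Ω → ℝ) : Prop :=
  ∀ Xs : ℕ → Ω → ℝ, (∀ n, Xs n ∈ K) → TendstoInMeasure P Xs atTop X →
    ∀ W : ℕ → Ω → ℝ, IsFCC Xs W → TendstoInMeasure P W atTop X

/-- The set `L = {Σ_k a_k R_k : Σ_k |a_k| ≤ 1}` (with pointwise a.e. absolutely convergent
series, which also converge in `L¹(P)`). -/
def Lset (R : ℕ → Ω → ℝ) : Set (Ω → ℝ) :=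
  {G | ∃ a : ℕ → ℝ, Summable (fun k => |a k|) ∧ (∑' k, |a k|) ≤ 1 ∧
    G = fun ω => ∑' k, a k * R k ω}

/-- The standard Cauchy distribution on `ℝ`. -/
def cauchyLaw : Measure ℝ :=
  MeasureTheory.volume.withDensity (fun t => ENNReal.ofReal (1 / (Real.pi * (1 + t ^ 2))))

/-- Local convexity of the relative topology on `A ⊆ E` at a point `x ∈ A`, in a topological
vector space. -/
def LocConvexAtTVS {E : Type*} [AddCommGroup E] [Module ℝ E] [TopologicalSpace E]
    (A : Set E) (x : E) : Prop :=
  ∀ V ∈ nhds (0 : E), ∃ U ∈ nhds (0 : E), ∃ C : Set E,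
    Convex ℝ C ∧ ((fun u => x + u) '' U) ∩ A ⊆ C ∧ C ⊆ ((fun v => x + v) '' V) ∩ A

lemma exp_neg_abs_bounds (x : ℝ) : 0 ≤ Real.exp (-|x|) ∧ Real.exp (-|x|) ≤ 1 :=
  ⟨(Real.exp_pos _).le, Real.exp_le_one_iff.2 (neg_nonpos.2 (abs_nonneg x))⟩

lemma integrable_exp_neg_abs {P : Measure Ω} [IsFiniteMeasure P] {Z : Ω → ℝ}
    (hZ : AEStronglyMeasurable Z P) : Integrable (fun ω => Real.exp (-|Z ω|)) P := by
  refine Integrable.of_bound (C := 1) ?_ (ae_of_all _ fun ω => ?_)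
  · exact Real.continuous_exp.comp_aestronglyMeasurable hZ.norm.neg
  · rw [Real.norm_of_nonneg (exp_neg_abs_bounds _).1]
    exact (exp_neg_abs_bounds _).2

lemma integrable_min_abs_one {P : Measure Ω} [IsFiniteMeasure P] {Z : Ω → ℝ}
    (hZ : AEStronglyMeasurable Z P) : Integrable (fun ω => min |Z ω| 1) P := by
  refine Integrable.of_bound (C := 1) ?_ (ae_of_all _ fun ω => ?_)
  · exact (continuous_id.min continuous_const).comp_aestronglyMeasurable hZ.norm
  · rw [Real.norm_of_nonneg (by positivity)]
    exact min_le_right _ _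

lemma one_sub_exp_neg_le_min {a : ℝ} : 1 - Real.exp (-a) ≤ min a 1 := by
  have h1 := Real.add_one_le_exp (-a)
  have h2 := Real.exp_pos (-a)
  exact le_min (by linarith) (by linarith)

/-- Integrated form of the strict convexity of `t ↦ exp (-t)`. -/
lemma integral_sq_exp_half_sub {P : Measure Ω} [IsFiniteMeasure P] {Y Z : Ω → ℝ}
    (hY : AEStronglyMeasurable Y P) (hZ : AEStronglyMeasurable Z P) :
    ∫ ω, (Real.exp (-|Y ω| / 2) - Real.exp (-|Z ω| / 2)) ^ 2 ∂P =
      ∫ ω, Real.exp (-|Y ω|) ∂P + ∫ ω, Real.exp (-|Z ω|) ∂P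
        - 2 * ∫ ω, Real.exp (-|((1 / 2 : ℝ) * |Y ω| + (1 / 2) * |Z ω|)|) ∂P := by
  rw [← integral_const_mul, ← integral_add (integrable_exp_neg_abs hY) (integrable_exp_neg_abs hZ),
    ← integral_sub]
  · congr 1 with ω
    have h1 : |((1 / 2 : ℝ) * |Y ω| + (1 / 2) * |Z ω|)| = |Y ω| / 2 + |Z ω| / 2 := by
      rw [abs_of_nonneg (by positivity)]; ring
    have h2 : ∀ t : ℝ, Real.exp (-t) = Real.exp (-t / 2) ^ 2 := fun t => by
      rw [← Real.exp_nat_mul]; congr 1; push_cast; ring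
    rw [h1, h2 |Y ω|, h2 |Z ω|, show -(|Y ω| / 2 + |Z ω| / 2) = -|Y ω| / 2 + -|Z ω| / 2 by ring,
      Real.exp_add]
    ring
  · exact (integrable_exp_neg_abs hY).add (integrable_exp_neg_abs hZ)
  · exact (integrable_exp_neg_abs
      ((hY.norm.const_mul (1 / 2 : ℝ)).add (hZ.norm.const_mul (1 / 2 : ℝ)))).const_mul 2

/-- A maximizing sequence for `Z ↦ 1 - E[exp (-|Z|)]` over a convex solid set can be chosen so
that `exp (-|Z n|)` converges almost surely. -/
lemma exists_minimizing_seq {P : Measure Ω} [IsProbabilityMeasure P] {W : Set (Ω → ℝ)}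
    (hWne : W.Nonempty) (hWint : ∀ Z ∈ W, Integrable Z P) (hWconv : Convex ℝ W)
    (hWsolid : SolidSet P W) :
    ∃ (α : ℝ) (Z : ℕ → Ω → ℝ) (h : Ω → ℝ), (∀ Y ∈ W, α ≤ ∫ ω, Real.exp (-|Y ω|) ∂P) ∧
      (∀ n, Z n ∈ W) ∧ Tendsto (fun n => ∫ ω, Real.exp (-|Z n ω|) ∂P) atTop (nhds α) ∧
      Measurable h ∧ (∀ ω, 0 ≤ h ω ∧ h ω ≤ 1) ∧
      ∀ᵐ ω ∂P, Tendsto (fun n => Real.exp (-|Z n ω|)) atTop (nhds (h ω)) := by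
  set V : Set ℝ := (fun Y : Ω → ℝ => ∫ ω, Real.exp (-|Y ω|) ∂P) '' W with hV
  have hVbdd : BddBelow V := by
    refine ⟨0, ?_⟩
    rintro _ ⟨Y, -, rfl⟩
    exact integral_nonneg fun ω => (exp_neg_abs_bounds _).1
  have hα : ∀ Y ∈ W, sInf V ≤ ∫ ω, Real.exp (-|Y ω|) ∂P := fun Y hY =>
    csInf_le hVbdd ⟨Y, hY, rfl⟩
  have habs : ∀ Y ∈ W, (fun ω => |Y ω|) ∈ W := fun Y hY =>
    hWsolid Y hY _ (hWint Y hY).1.norm (ae_of_all _ fun ω => (abs_abs _).le)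
  have hex : ∀ n : ℕ, ∃ Y ∈ W, ∫ ω, Real.exp (-|Y ω|) ∂P < sInf V + (1 / 4) ^ n / 4 := fun n => by
    obtain ⟨_, ⟨Y, hY, rfl⟩, hlt⟩ := exists_lt_of_csInf_lt (hWne.image _)
      (show sInf V < sInf V + (1 / 4 : ℝ) ^ n / 4 by
        have : (0 : ℝ) < (1 / 4 : ℝ) ^ n / 4 := by positivity
        linarith)
    exact ⟨Y, hY, hlt⟩
  choose Z hZW hZlt using hex
  have hZm : ∀ n, AEStronglyMeasurable (Z n) P := fun n => (hWint _ (hZW n)).1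
  set y : ℕ → Ω → ℝ := fun n ω => Real.exp (-|Z n ω| / 2) with hy
  have hym : ∀ n, AEStronglyMeasurable (y n) P := fun n =>
    Real.continuous_exp.comp_aestronglyMeasurable
      (AEMeasurable.aestronglyMeasurable (by have := (hZm n).aemeasurable; fun_prop))
  have hybd : ∀ n ω, 0 ≤ y n ω ∧ y n ω ≤ 1 := fun n ω =>
    ⟨(Real.exp_pos _).le, Real.exp_le_one_iff.2 (by have := abs_nonneg (Z n ω); linarith)⟩
  have hsq : ∀ n ω, Real.exp (-|Z n ω|) = y n ω ^ 2 := fun n ω => by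
    rw [hy, ← Real.exp_nat_mul]; congr 1; push_cast; ring
  have hyLp : ∀ n, MemLp (y n) 2 P := fun n =>
    MemLp.of_bound (hym n) 1 (ae_of_all _ fun ω => by
      rw [Real.norm_of_nonneg (hybd n ω).1]; exact (hybd n ω).2)
  have hcau : ∀ N n m : ℕ, N ≤ n → N ≤ m →
      eLpNorm (y n - y m) 2 P < ENNReal.ofReal ((1 / 2) ^ N) := by
    intro N n m hn hm
    have h1 := integral_sq_exp_half_sub (hZm n) (hZm m)
    have h2 := hα _ (hWconv (habs _ (hZW n)) (habs _ (hZW m)) (a := 1 / 2) (b := 1 / 2)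
      (by norm_num) (by norm_num) (by norm_num))
    simp only [Pi.add_apply, Pi.smul_apply, smul_eq_mul] at h2
    have hp : ∀ k, N ≤ k → ((1 / 4 : ℝ)) ^ k ≤ (1 / 4) ^ N := fun k hk =>
      pow_le_pow_of_le_one (by norm_num) (by norm_num) hk
    have h3 : ∫ ω, (y n ω - y m ω) ^ 2 ∂P < (1 / 4) ^ N := by
      have := hZlt n
      have := hZlt m
      have := hp n hn
      have := hp m hm
      have : (0 : ℝ) < (1 / 4) ^ N := by positivity
      simp only [hy]
      linarith
    rw [MemLp.eLpNorm_eq_integral_rpow_norm (by norm_num) (by norm_num) ((hyLp n).sub (hyLp m))]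
    refine (ENNReal.ofReal_lt_ofReal_iff (by positivity)).2 ?_
    have h4 : ∫ ω, ‖(y n - y m) ω‖ ^ (2 : ENNReal).toReal ∂P = ∫ ω, (y n ω - y m ω) ^ 2 ∂P := by
      congr 1 with ω
      simp
    rw [h4, ENNReal.toReal_ofNat, ← one_div, ← Real.sqrt_eq_rpow, Real.sqrt_lt' (by positivity),
      ← pow_mul, mul_comm, pow_mul]
    convert h3 using 2
    norm_num
  have hsum : ∑' i : ℕ, ENNReal.ofReal ((1 / 2 : ℝ) ^ i) ≠ ⊤ :=
    (summable_geometric_two).tsum_ofReal_ne_top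
  obtain ⟨g, hgm, hg⟩ := exists_stronglyMeasurable_limit_of_tendsto_ae hym
    (Lp.ae_tendsto_of_cauchy_eLpNorm hym (by norm_num) hsum hcau)
  refine ⟨sInf V, Z, fun ω => max 0 (min 1 (g ω ^ 2)), hα, hZW, ?_, ?_, ?_, ?_⟩
  · have h0 : Tendsto (fun n : ℕ => sInf V + (1 / 4 : ℝ) ^ n / 4) atTop (nhds (sInf V)) := by
      simpa using ((tendsto_pow_atTop_nhds_zero_of_lt_one (by norm_num : (0 : ℝ) ≤ 1 / 4)
        (by norm_num)).div_const 4).const_add (sInf V)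
    exact tendsto_of_tendsto_of_tendsto_of_le_of_le tendsto_const_nhds h0
      (fun n => hα _ (hZW n)) (fun n => (hZlt n).le)
  · exact measurable_const.max (measurable_const.min (hgm.measurable.pow_const 2))
  · exact fun ω => ⟨le_max_left _ _, max_le zero_le_one (min_le_left _ _)⟩
  · filter_upwards [hg] with ω hω
    have h1 : Tendsto (fun n => Real.exp (-|Z n ω|)) atTop (nhds (g ω ^ 2)) := by
      simp only [hsq]
      exact hω.pow 2
    rwa [min_eq_right (le_of_tendsto' h1 fun n => (exp_neg_abs_bounds _).2),
      max_eq_right (sq_nonneg _)]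

/-- A convex solid set of integrable random variables contained in a small `L⁰(P)`-ball is
contained in a small weighted `L¹(P)`-ball, for a weight close to `1`. -/
lemma exists_weight {P : Measure Ω} [IsProbabilityMeasure P] {W : Set (Ω → ℝ)} {ε : ℝ}
    (hWne : W.Nonempty) (hWint : ∀ Z ∈ W, Integrable Z P) (hWconv : Convex ℝ W)
    (hWsolid : SolidSet P W) (hWball : ∀ Z ∈ W, probDist P Z 0 < ε) :
    ∃ h : Ω → ℝ, Measurable h ∧ (∀ ω, 0 ≤ h ω ∧ h ω ≤ 1) ∧ ∫ ω, (1 - h ω) ∂P ≤ ε ∧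
      ∀ Z ∈ W, ∫ ω, h ω * |Z ω| ∂P ≤ ε := by
  obtain ⟨α, Y, h, hα, hYW, hYα, hhm, hhb, hYh⟩ :=
    exists_minimizing_seq hWne hWint hWconv hWsolid
  have hYm : ∀ n, AEStronglyMeasurable (Y n) P := fun n => (hWint _ (hYW n)).1
  have hYi : ∀ n, Integrable (fun ω => Real.exp (-|Y n ω|)) P := fun n =>
    integrable_exp_neg_abs (hYm n)
  have hhi : Integrable h P := Integrable.of_bound (C := 1) hhm.aestronglyMeasurable
    (ae_of_all _ fun ω => by rw [Real.norm_of_nonneg (hhb ω).1]; exact (hhb ω).2)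
  have hαh : ∫ ω, h ω ∂P = α := by
    refine tendsto_nhds_unique (tendsto_integral_of_dominated_convergence (fun _ => 1)
      (fun n => (hYi n).1) (integrable_const _) (fun n => ae_of_all _ fun ω => ?_) hYh) hYα
    rw [Real.norm_of_nonneg (exp_neg_abs_bounds _).1]
    exact (exp_neg_abs_bounds _).2
  have hYε : ∀ n, 1 - ∫ ω, Real.exp (-|Y n ω|) ∂P ≤ ε := fun n => by
    have h1 : ∫ ω, (1 - Real.exp (-|Y n ω|)) ∂P ≤ ∫ ω, min |Y n ω| 1 ∂P :=
      integral_mono ((integrable_const _).sub (hYi n)) (integrable_min_abs_one (hYm n))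
        fun ω => one_sub_exp_neg_le_min
    rw [integral_sub (integrable_const _) (hYi n)] at h1
    have h2 := hWball _ (hYW n)
    simp only [probDist, Pi.zero_apply, sub_zero] at h2
    simp only [integral_const, probReal_univ, smul_eq_mul, mul_one] at h1
    linarith
  have hαε : 1 - α ≤ ε := le_of_tendsto' (hYα.const_sub 1) hYε
  refine ⟨h, hhm, hhb, ?_, fun Z hZ => ?_⟩
  · rw [integral_sub (integrable_const _) hhi, hαh]
    simpa using hαε
  have habs : ∀ Y ∈ W, (fun ω => |Y ω|) ∈ W := fun Y hY =>
    hWsolid Y hY _ (hWint Y hY).1.norm (ae_of_all _ fun ω => (abs_abs _).le)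
  have hZm := (hWint Z hZ).1
  have hstep : ∀ l : ℝ, 0 < l → l < 1 →
      ∫ ω, h ω * (1 - Real.exp (-(l * |Z ω|))) ∂P ≤ l * ε := by
    intro l hl0 hl1
    have hEm : AEStronglyMeasurable (fun ω => 1 - Real.exp (-(l * |Z ω|))) P :=
      aestronglyMeasurable_const.sub
        (Real.continuous_exp.comp_aestronglyMeasurable (hZm.norm.const_mul l).neg)
    have hEb : ∀ ω, 0 ≤ 1 - Real.exp (-(l * |Z ω|)) ∧ 1 - Real.exp (-(l * |Z ω|)) ≤ 1 := fun ω => by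
      have h1 : Real.exp (-(l * |Z ω|)) ≤ 1 :=
        Real.exp_le_one_iff.2 (neg_nonpos.2 (by positivity))
      have h2 := Real.exp_pos (-(l * |Z ω|))
      constructor <;> linarith
    have hFb : ∀ n ω, ‖Real.exp (-|Y n ω|) * (1 - Real.exp (-(l * |Z ω|)))‖ ≤ 1 := fun n ω => by
      rw [Real.norm_of_nonneg (mul_nonneg (exp_neg_abs_bounds _).1 (hEb ω).1)]
      exact mul_le_one₀ (exp_neg_abs_bounds _).2 (hEb ω).1 (hEb ω).2
    have hlim : Tendsto (fun n => ∫ ω, Real.exp (-|Y n ω|) * (1 - Real.exp (-(l * |Z ω|))) ∂P)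
        atTop (nhds (∫ ω, h ω * (1 - Real.exp (-(l * |Z ω|))) ∂P)) := by
      refine tendsto_integral_of_dominated_convergence (fun _ => 1)
        (fun n => (hYi n).1.mul hEm) (integrable_const _) (fun n => ae_of_all _ (hFb n)) ?_
      filter_upwards [hYh] with ω hω
      exact hω.mul_const _
    have hrhs : Tendsto (fun n => (1 - l) * ∫ ω, Real.exp (-|Y n ω|) ∂P + l - α) atTop
        (nhds ((1 - l) * α + l - α)) := ((hYα.const_mul (1 - l)).add_const l).sub_const α
    refine (le_of_tendsto_of_tendsto' hlim hrhs fun n => ?_).trans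
      (by nlinarith [mul_le_mul_of_nonneg_left hαε hl0.le])
    have hmix := hα _ (hWconv (habs _ (hYW n)) (habs _ hZ) (a := 1 - l) (b := l)
      (by linarith) hl0.le (by ring))
    simp only [Pi.add_apply, Pi.smul_apply, smul_eq_mul] at hmix
    have hMi : Integrable (fun ω => Real.exp (-|((1 - l) * |Y n ω| + l * |Z ω|)|)) P :=
      integrable_exp_neg_abs (((hYm n).norm.const_mul (1 - l)).add (hZm.norm.const_mul l))
    have hFi : Integrable (fun ω => (1 - l) * Real.exp (-|Y n ω|) + l) P :=
      ((hYi n).const_mul _).add (integrable_const _)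
    have hle : ∫ ω, Real.exp (-|Y n ω|) * (1 - Real.exp (-(l * |Z ω|))) ∂P ≤
        ∫ ω, ((1 - l) * Real.exp (-|Y n ω|) + l
          - Real.exp (-|((1 - l) * |Y n ω| + l * |Z ω|)|)) ∂P := by
      refine integral_mono (Integrable.of_bound ((hYi n).1.mul hEm) 1 (ae_of_all _ (hFb n)))
        (hFi.sub hMi) fun ω => ?_
      have ha := abs_nonneg (Y n ω)
      have hcvx : Real.exp (-((1 - l) * |Y n ω|)) ≤ (1 - l) * Real.exp (-|Y n ω|) + l := by
        have := convexOn_exp.2 (mem_univ (-|Y n ω|)) (mem_univ (0 : ℝ))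
          (show 0 ≤ 1 - l by linarith) hl0.le (by ring)
        simpa using this
      have hmon : Real.exp (-|Y n ω|) ≤ Real.exp (-((1 - l) * |Y n ω|)) :=
        Real.exp_le_exp.2 (by nlinarith)
      have hprod : Real.exp (-|((1 - l) * |Y n ω| + l * |Z ω|)|) =
          Real.exp (-((1 - l) * |Y n ω|)) * Real.exp (-(l * |Z ω|)) := by
        rw [← Real.exp_add, abs_of_nonneg]
        · congr 1; ring
        · have : 0 ≤ 1 - l := by linarith
          positivity
      have := mul_le_mul_of_nonneg_right hmon (hEb ω).1
      simp only [hprod]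
      linarith
    rw [integral_sub hFi hMi, integral_add ((hYi n).const_mul _) (integrable_const _),
      integral_const_mul] at hle
    simp only [integral_const, probReal_univ, smul_eq_mul, one_mul] at hle
    linarith
  have hlim : Tendsto (fun n : ℕ => ∫ ω, h ω * (|Z ω| / (1 + 1 / ((n : ℝ) + 2) * |Z ω|)) ∂P) atTop
      (nhds (∫ ω, h ω * |Z ω| ∂P)) := by
    refine tendsto_integral_of_dominated_convergence (fun ω => |Z ω|) (fun n => ?_)
      (hWint Z hZ).abs (fun n => ae_of_all _ fun ω => ?_) (ae_of_all _ fun ω => ?_)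
    · have : AEMeasurable Z P := hZm.aemeasurable
      have hh := hhm.aemeasurable (μ := P)
      exact AEMeasurable.aestronglyMeasurable (by fun_prop)
    · rw [Real.norm_of_nonneg (mul_nonneg (hhb ω).1 (by positivity))]
      refine (mul_le_of_le_one_left (by positivity) (hhb ω).2).trans
        (div_le_self (abs_nonneg _) ?_)
      have : 0 ≤ 1 / ((n : ℝ) + 2) * |Z ω| := by positivity
      linarith
    · have h0 : Tendsto (fun n : ℕ => 1 / ((n : ℝ) + 2)) atTop (nhds 0) :=
        tendsto_const_nhds.div_atTop
          (tendsto_atTop_add_const_right _ _ tendsto_natCast_atTop_atTop)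
      have h1 := (tendsto_const_nhds (x := |Z ω|)).div ((h0.mul_const |Z ω|).const_add 1)
        (by simp)
      simpa using h1.const_mul (h ω)
  refine le_of_tendsto' hlim fun n => ?_
  set l : ℝ := 1 / ((n : ℝ) + 2) with hl
  have hl0 : 0 < l := by positivity
  have hl1 : l < 1 := by
    rw [hl, div_lt_one (by positivity)]
    have : (0 : ℝ) ≤ n := n.cast_nonneg
    linarith
  have hle : ∫ ω, l * (h ω * (|Z ω| / (1 + l * |Z ω|))) ∂P ≤
      ∫ ω, h ω * (1 - Real.exp (-(l * |Z ω|))) ∂P := by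
    refine integral_mono_of_nonneg (ae_of_all _ fun ω => ?_) ?_ (ae_of_all _ fun ω => ?_)
    · have := (hhb ω).1
      simp only [Pi.zero_apply]
      positivity
    · have := hZm.aemeasurable
      have hh := hhm.aemeasurable (μ := P)
      refine Integrable.of_bound (C := 1) (AEMeasurable.aestronglyMeasurable (by fun_prop))
        (ae_of_all _ fun ω => ?_)
      have h1 : Real.exp (-(l * |Z ω|)) ≤ 1 :=
        Real.exp_le_one_iff.2 (neg_nonpos.2 (by positivity))
      have h2 := Real.exp_pos (-(l * |Z ω|))
      rw [Real.norm_of_nonneg (mul_nonneg (hhb ω).1 (by linarith))]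
      exact mul_le_one₀ (hhb ω).2 (by linarith) (by linarith)
    · have hb : 0 ≤ l * |Z ω| := by positivity
      have h1 : Real.exp (-(l * |Z ω|)) ≤ 1 / (1 + l * |Z ω|) := by
        rw [Real.exp_neg, ← one_div]
        exact one_div_le_one_div_of_le (by linarith) (by linarith [Real.add_one_le_exp (l * |Z ω|)])
      have h2 : l * (|Z ω| / (1 + l * |Z ω|)) = 1 - 1 / (1 + l * |Z ω|) := by
        field_simp
        ring
      calc l * (h ω * (|Z ω| / (1 + l * |Z ω|)))
          = h ω * (l * (|Z ω| / (1 + l * |Z ω|))) := by ring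
        _ ≤ h ω * (1 - Real.exp (-(l * |Z ω|))) :=
          mul_le_mul_of_nonneg_left (by linarith) (hhb ω).1
  rw [integral_const_mul] at hle
  exact le_of_mul_le_mul_left (hle.trans (hstep l hl0 hl1)) hl0

lemma tendsto_probDist_of_ae {P : Measure Ω} [IsFiniteMeasure P] {Z : ℕ → Ω → ℝ} {X : Ω → ℝ}
    (hZ : ∀ n, AEStronglyMeasurable (Z n) P) (hX : AEStronglyMeasurable X P)
    (h : ∀ᵐ ω ∂P, Tendsto (fun n => Z n ω) atTop (nhds (X ω))) :
    Tendsto (fun n => probDist P (Z n) X) atTop (nhds 0) := by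
  have h0 : (0 : ℝ) = ∫ _, (0 : ℝ) ∂P := by simp
  rw [h0]
  refine tendsto_integral_of_dominated_convergence (fun _ => 1)
    (fun n => (integrable_min_abs_one ((hZ n).sub hX)).1) (integrable_const _)
    (fun n => ae_of_all _ fun ω => ?_) ?_
  · rw [Real.norm_of_nonneg (by positivity)]
    exact min_le_right _ _
  · filter_upwards [h] with ω hω
    simpa using ((hω.sub_const (X ω)).abs).min (tendsto_const_nhds (x := (1 : ℝ)))

lemma tendsto_probDist_of_tendstoInMeasure {P : Measure Ω} [IsFiniteMeasure P]
    {Z : ℕ → Ω → ℝ} {X : Ω → ℝ} (hZ : ∀ n, AEStronglyMeasurable (Z n) P)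
    (hX : AEStronglyMeasurable X P) (h : TendstoInMeasure P Z atTop X) :
    Tendsto (fun n => probDist P (Z n) X) atTop (nhds 0) := by
  refine tendsto_of_subseq_tendsto fun ns hns => ?_
  obtain ⟨ms, -, hms⟩ := TendstoInMeasure.exists_seq_tendsto_ae (h.comp hns)
  exact ⟨ms, tendsto_probDist_of_ae (fun n => hZ _) hX hms⟩

lemma tendstoInMeasure_of_tendsto_probDist {P : Measure Ω} [IsFiniteMeasure P]
    {Z : ℕ → Ω → ℝ} {X : Ω → ℝ} (hZ : ∀ n, AEStronglyMeasurable (Z n) P)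
    (hX : AEStronglyMeasurable X P) (h : Tendsto (fun n => probDist P (Z n) X) atTop (nhds 0)) :
    TendstoInMeasure P Z atTop X := by
  rw [tendstoInMeasure_iff_measureReal_norm]
  intro ε hε
  have hδ : 0 < min ε 1 := lt_min hε one_pos
  have h1 : Tendsto (fun n => probDist P (Z n) X / min ε 1) atTop (nhds 0) := by
    simpa using h.div_const (min ε 1)
  refine squeeze_zero (fun n => measureReal_nonneg) (fun n => ?_) h1
  rw [le_div_iff₀ hδ, mul_comm]
  have h2 := mul_meas_ge_le_integral_of_nonneg (μ := P) (f := fun ω => min |Z n ω - X ω| 1)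
    (ae_of_all _ fun ω => by simp only [Pi.zero_apply]; positivity)
    (integrable_min_abs_one ((hZ n).sub hX)) (min ε 1)
  refine (mul_le_mul_of_nonneg_left (measureReal_mono fun ω hω => ?_) hδ.le).trans h2
  exact min_le_min_right (1 : ℝ) (show ε ≤ |Z n ω - X ω| from hω)

/-- For equivalent measures, small balls of `L¹(Q)` are contained in small balls of `L⁰(P)`. -/
lemma exists_pos_lintegral_le_imp_probDist_lt {P Q : Measure Ω} [IsFiniteMeasure P]
    [IsFiniteMeasure Q] (hQP : Q ≪ P) (hPQ : P ≪ Q) {ε : ℝ} (hε : 0 < ε) :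
    ∃ η : ENNReal, 0 < η ∧ ∀ Z : Ω → ℝ, AEStronglyMeasurable Z P →
      ∫⁻ ω, ENNReal.ofReal |Z ω| ∂Q ≤ η → probDist P Z 0 < ε := by
  by_contra! hcon
  choose Z hZm hZη hZε using fun n : ℕ => hcon (((n : ENNReal) + 1)⁻¹) (by simp)
  have hlim : Tendsto (fun n => eLpNorm (Z n - 0) 1 Q) atTop (nhds 0) := by
    have h0 : Tendsto (fun n : ℕ => ((n : ENNReal) + 1)⁻¹) atTop (nhds 0) := by
      have := (tendsto_add_atTop_iff_nat 1).2 ENNReal.tendsto_inv_nat_nhds_zero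
      simpa using this
    refine tendsto_of_tendsto_of_tendsto_of_le_of_le tendsto_const_nhds h0
      (fun _ => zero_le) fun n => ?_
    simpa [eLpNorm_one_eq_lintegral_enorm, Real.enorm_eq_ofReal_abs] using hZη n
  obtain ⟨ns, -, hns⟩ := (tendstoInMeasure_of_tendsto_eLpNorm one_ne_zero
    (fun n => (hZm n).mono_ac hQP) aestronglyMeasurable_zero hlim).exists_seq_tendsto_ae
  have := tendsto_probDist_of_ae (fun n => hZm (ns n)) aestronglyMeasurable_zero
    (hPQ.ae_le hns)
  exact absurd (ge_of_tendsto' this fun n => hZε (ns n)) (not_le.2 hε)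

lemma unifLCS_of_equivProb {P Q : Measure Ω} [IsProbabilityMeasure P] {K S : Set (Ω → ℝ)}
    (hK : ∀ X ∈ K, Integrable X P) (hSK : S ⊆ K) (hQ : EquivProb P Q)
    (hconv : ∀ (Xs : ℕ → Ω → ℝ) (X : Ω → ℝ), (∀ n, Xs n ∈ K) → X ∈ S →
      TendstoInMeasure P Xs atTop X →
      Tendsto (fun n => ∫⁻ ω, ENNReal.ofReal |Xs n ω - X ω| ∂Q) atTop (nhds 0)) :
    UnifLCS P K S := by
  obtain ⟨hQprob, hQP, hPQ⟩ := hQ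
  intro ε hε
  obtain ⟨η, hη, hball⟩ := exists_pos_lintegral_le_imp_probDist_lt hQP hPQ hε
  refine ⟨{Z | Integrable Z P ∧ ∫⁻ ω, ENNReal.ofReal |Z ω| ∂Q ≤ η}, fun Z hZ => hZ.1, ?_, ?_,
    fun Z hZ => hball Z hZ.1.1 hZ.2, fun X hX => ?_⟩
  · intro Y hY Z hZ a b ha hb hab
    refine ⟨(hY.1.smul a).add (hZ.1.smul b), ?_⟩
    have hYm : AEMeasurable Y Q := (hY.1.1.mono_ac hQP).aemeasurable
    calc ∫⁻ ω, ENNReal.ofReal |(a • Y + b • Z) ω| ∂Q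
        ≤ ∫⁻ ω, (ENNReal.ofReal a * ENNReal.ofReal |Y ω|
            + ENNReal.ofReal b * ENNReal.ofReal |Z ω|) ∂Q := by
          refine lintegral_mono fun ω => ?_
          rw [← ENNReal.ofReal_mul ha, ← ENNReal.ofReal_mul hb,
            ← ENNReal.ofReal_add (by positivity) (by positivity)]
          refine ENNReal.ofReal_le_ofReal ((abs_add_le _ _).trans ?_)
          simp [abs_mul, abs_of_nonneg ha, abs_of_nonneg hb]
      _ = ENNReal.ofReal a * ∫⁻ ω, ENNReal.ofReal |Y ω| ∂Q
            + ENNReal.ofReal b * ∫⁻ ω, ENNReal.ofReal |Z ω| ∂Q := by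
          rw [lintegral_add_left' (by fun_prop), lintegral_const_mul' _ _ ENNReal.ofReal_ne_top,
            lintegral_const_mul' _ _ ENNReal.ofReal_ne_top]
      _ ≤ ENNReal.ofReal a * η + ENNReal.ofReal b * η := by
          gcongr
          exacts [hY.2, hZ.2]
      _ = η := by rw [← add_mul, ← ENNReal.ofReal_add ha hb, hab, ENNReal.ofReal_one, one_mul]
  · intro X hX Y hYm hYX
    refine ⟨hX.1.mono hYm hYX, (lintegral_mono_ae ?_).trans hX.2⟩
    filter_upwards [hQP.ae_le hYX] with ω hω
    exact ENNReal.ofReal_le_ofReal hω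
  · by_contra! hcon
    choose Z hZK hZX hZW using fun n : ℕ => hcon (1 / ((n : ℝ) + 1)) (by positivity)
    have hXi := hK X (hSK hX)
    have hdist : Tendsto (fun n => probDist P (Z n) X) atTop (nhds 0) :=
      squeeze_zero (fun n => integral_nonneg fun ω => by simp only [Pi.zero_apply]; positivity)
        (fun n => (hZX n).le) tendsto_one_div_add_atTop_nhds_zero_nat
    have hlim := hconv Z X hZK hX
      (tendstoInMeasure_of_tendsto_probDist (fun n => (hK _ (hZK n)).1) hXi.1 hdist)
    obtain ⟨n, hn⟩ := (hlim.eventually (ge_mem_nhds hη)).exists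
    exact hZW n ⟨(hK _ (hZK n)).sub hXi, hn⟩

/-- The probability obtained by normalizing `∑ m, 2⁻ᵐ • P.restrict (B m)`. -/
lemma exists_equivProb_of_iUnion {P : Measure Ω} [IsProbabilityMeasure P] {B : ℕ → Set Ω}
    (hB : ∀ᵐ ω ∂P, ∃ m, ω ∈ B m) :
    ∃ (Q : Measure Ω) (c : ENNReal), c ≠ ⊤ ∧ EquivProb P Q ∧ ∀ f : Ω → ENNReal,
      ∫⁻ ω, f ω ∂Q = c * ∑' m : ℕ, ENNReal.ofReal ((1 / 2) ^ m) * ∫⁻ ω in B m, f ω ∂P := by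
  set M : Measure Ω :=
    Measure.sum fun m : ℕ => ENNReal.ofReal ((1 / 2) ^ m) • P.restrict (B m) with hM
  have hMint : ∀ f : Ω → ENNReal, ∫⁻ ω, f ω ∂M =
      ∑' m : ℕ, ENNReal.ofReal ((1 / 2) ^ m) * ∫⁻ ω in B m, f ω ∂P := fun f => by
    rw [hM, lintegral_sum_measure]
    simp only [lintegral_smul_measure, smul_eq_mul]
  have hMP : M ≪ P := by
    refine Measure.absolutelyContinuous_sum_left fun m => ?_
    exact (Measure.restrict_le_self.absolutelyContinuous).smul_left _
  have hPM : P ≪ M := by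
    refine Measure.AbsolutelyContinuous.mk fun s hs hMs => ?_
    rw [hM, Measure.sum_apply _ hs, ENNReal.tsum_eq_zero] at hMs
    have h1 : ∀ m, P (s ∩ B m) = 0 := fun m => by
      have := hMs m
      rw [Measure.smul_apply, Measure.restrict_apply hs, smul_eq_mul, mul_eq_zero] at this
      exact this.resolve_left (by simp)
    refine measure_mono_null_ae ?_ (measure_iUnion_null h1)
    filter_upwards [hB] with ω ⟨m, hm⟩ hωs
    exact mem_iUnion.2 ⟨m, hωs, hm⟩
  have hM0 : M univ ≠ 0 := fun h => by simpa using hPM h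
  have hMtop : M univ ≠ ⊤ := by
    refine ne_top_of_le_ne_top (summable_geometric_two.tsum_ofReal_ne_top) ?_
    rw [← lintegral_one, hMint]
    refine ENNReal.tsum_le_tsum fun m => ?_
    rw [lintegral_one, Measure.restrict_apply_univ]
    exact mul_le_of_le_one_right zero_le prob_le_one
  have hc0 : (M univ)⁻¹ ≠ 0 := ENNReal.inv_ne_zero.2 hMtop
  refine ⟨(M univ)⁻¹ • M, (M univ)⁻¹, ENNReal.inv_ne_top.2 hM0, ⟨⟨?_⟩, hMP.smul_left _, ?_⟩,
    fun f => ?_⟩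
  · rw [Measure.smul_apply, smul_eq_mul, ENNReal.inv_mul_cancel hM0 hMtop]
  · exact hPM.trans (Measure.absolutelyContinuous_smul hc0)
  · rw [lintegral_smul_measure, smul_eq_mul, hMint]

lemma tendsto_tsum_ennreal_of_dominated {F : ℕ → ℕ → ENNReal} {b : ℕ → ENNReal}
    (hb : ∑' m, b m ≠ ⊤) (hFb : ∀ n m, F n m ≤ b m)
    (hF : ∀ m, Tendsto (fun n => F n m) atTop (nhds 0)) :
    Tendsto (fun n => ∑' m, F n m) atTop (nhds 0) := by
  have := tendsto_lintegral_of_dominated_convergence (μ := Measure.count) (F := F)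
    (f := fun _ => 0) b (fun n => measurable_of_countable _) (fun n => ae_of_all _ (hFb n))
    (by simpa [lintegral_count] using hb) (ae_of_all _ hF)
  simpa [lintegral_count] using this

lemma exists_equivProb_of_unifLCS {P : Measure Ω} [IsProbabilityMeasure P] {K S : Set (Ω → ℝ)}
    (hKbdd : BddL1 P K) (hS : S.Nonempty) (hSK : S ⊆ K) (hLCS : UnifLCS P K S) :
    ∃ Q : Measure Ω, EquivProb P Q ∧
      ∀ (Xs : ℕ → Ω → ℝ) (X : Ω → ℝ), (∀ n, Xs n ∈ K) → X ∈ S →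
        TendstoInMeasure P Xs atTop X →
        Tendsto (fun n => ∫⁻ ω, ENNReal.ofReal |Xs n ω - X ω| ∂Q) atTop (nhds 0) := by
  obtain ⟨hKint, C, hC⟩ := hKbdd
  choose W hWint hWconv hWsolid hWball hWnhds using
    fun n : ℕ => hLCS ((1 / 2 : ℝ) ^ n) (by positivity)
  have hWne : ∀ n, (W n).Nonempty := fun n => by
    obtain ⟨X, hX⟩ := hS
    obtain ⟨δ, hδ, h⟩ := hWnhds n X hX
    exact ⟨_, h X (hSK hX) (by simpa [probDist] using hδ)⟩
  choose h hhm hhb hh1 hhW using fun n =>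
    exists_weight (hWne n) (hWint n) (hWconv n) (hWsolid n) (hWball n)
  set A : ℕ → Set Ω := fun n => {ω | h n ω < 1 / 2} with hA
  have hAm : ∀ n, MeasurableSet (A n) := fun n => measurableSet_lt (hhm n) measurable_const
  have hhi : ∀ n, Integrable (h n) P := fun n =>
    Integrable.of_bound (C := 1) (hhm n).aestronglyMeasurable
      (ae_of_all _ fun ω => by rw [Real.norm_of_nonneg (hhb n ω).1]; exact (hhb n ω).2)
  have hPA : ∀ n, P (A n) ≤ ENNReal.ofReal (2 * (1 / 2) ^ n) := fun n => by
    rw [← ofReal_measureReal]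
    refine ENNReal.ofReal_le_ofReal ?_
    have h2 := mul_meas_ge_le_integral_of_nonneg (μ := P) (f := fun ω => 1 - h n ω)
      (ae_of_all _ fun ω => sub_nonneg.2 (hhb n ω).2) ((integrable_const _).sub (hhi n)) (1 / 2)
    have h3 : P.real (A n) ≤ P.real {ω | 1 / 2 ≤ 1 - h n ω} :=
      measureReal_mono fun ω hω => by
        simp only [hA, mem_ofPred_eq] at hω ⊢
        linarith
    have h4 := hh1 n
    linarith
  set B : ℕ → Set Ω := fun m => ⋂ n ≥ m, (A n)ᶜ with hBdef
  have hB : ∀ᵐ ω ∂P, ∃ m, ω ∈ B m := by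
    have hsum : ∑' n, P (A n) ≠ ⊤ :=
      ne_top_of_le_ne_top ((summable_geometric_two.mul_left 2).tsum_ofReal_ne_top)
        (ENNReal.tsum_le_tsum hPA)
    filter_upwards [ae_eventually_notMem hsum] with ω hω
    obtain ⟨m, hm⟩ := eventually_atTop.1 hω
    exact ⟨m, mem_iInter₂.2 hm⟩
  have hBm : ∀ m, MeasurableSet (B m) := fun m =>
    MeasurableSet.iInter fun n => MeasurableSet.iInter fun _ => (hAm n).compl
  obtain ⟨Q, c, hc, hQ, hQint⟩ := exists_equivProb_of_iUnion hB
  refine ⟨Q, hQ, fun Xs X hXs hX hlim => ?_⟩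
  have hXi := hKint X (hSK hX)
  have hdist := tendsto_probDist_of_tendstoInMeasure (fun n => (hKint _ (hXs n)).1) hXi.1 hlim
  have hdi : ∀ n, Integrable (Xs n - X) P := fun n => (hKint _ (hXs n)).sub hXi
  have hsmall : ∀ m n k, m ≤ n → Xs k - X ∈ W n →
      ∫⁻ ω in B m, ENNReal.ofReal |Xs k ω - X ω| ∂P ≤ ENNReal.ofReal (2 * (1 / 2) ^ n) := by
    intro m n k hmn hk
    have hint : Integrable (fun ω => 2 * (h n ω * |(Xs k - X) ω|)) P :=
      ((hdi k).abs.bdd_mul (c := 1) (hhm n).aestronglyMeasurable (ae_of_all _ fun ω => by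
        rw [Real.norm_of_nonneg (hhb n ω).1]; exact (hhb n ω).2)).const_mul 2
    have hnn : ∀ ω, 0 ≤ 2 * (h n ω * |(Xs k - X) ω|) := fun ω => by
      have := (hhb n ω).1
      positivity
    calc ∫⁻ ω in B m, ENNReal.ofReal |Xs k ω - X ω| ∂P
        ≤ ∫⁻ ω in B m, ENNReal.ofReal (2 * (h n ω * |(Xs k - X) ω|)) ∂P := by
          refine setLIntegral_mono' (hBm m) fun ω hω => ENNReal.ofReal_le_ofReal ?_
          have h1 : ω ∉ A n := mem_iInter₂.1 hω n hmn
          have h2 : 1 / 2 ≤ h n ω := not_lt.1 h1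
          have h3 := abs_nonneg (Xs k ω - X ω)
          simp only [Pi.sub_apply]
          nlinarith
      _ ≤ ∫⁻ ω, ENNReal.ofReal (2 * (h n ω * |(Xs k - X) ω|)) ∂P := setLIntegral_le_lintegral _ _
      _ = ENNReal.ofReal (2 * ∫ ω, h n ω * |(Xs k - X) ω| ∂P) := by
          rw [← integral_const_mul, ofReal_integral_eq_lintegral_ofReal hint (ae_of_all _ hnn)]
      _ ≤ ENNReal.ofReal (2 * (1 / 2) ^ n) :=
          ENNReal.ofReal_le_ofReal (mul_le_mul_of_nonneg_left (hhW n _ hk) (by norm_num))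
  have hpiece : ∀ m, Tendsto (fun k => ∫⁻ ω in B m, ENNReal.ofReal |Xs k ω - X ω| ∂P) atTop
      (nhds 0) := by
    intro m
    have hgeo : Tendsto (fun n : ℕ => ENNReal.ofReal (2 * (1 / 2) ^ n)) atTop (nhds 0) := by
      have := ENNReal.tendsto_ofReal ((tendsto_pow_atTop_nhds_zero_of_lt_one
        (by norm_num : (0 : ℝ) ≤ 1 / 2) (by norm_num)).const_mul 2)
      simpa using this
    rw [ENNReal.tendsto_nhds_zero]
    intro η hη
    obtain ⟨n, hn, hmn⟩ := ((hgeo.eventually (ge_mem_nhds hη)).and (eventually_ge_atTop m)).exists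
    obtain ⟨δ, hδ, hW⟩ := hWnhds n X hX
    filter_upwards [hdist.eventually (gt_mem_nhds hδ)] with k hk
    exact (hsmall m n k hmn (hW _ (hXs k) hk)).trans hn
  have hbound : ∀ k m, ∫⁻ ω in B m, ENNReal.ofReal |Xs k ω - X ω| ∂P ≤
      ENNReal.ofReal (2 * C) := fun k m => by
    refine (setLIntegral_le_lintegral _ _).trans ?_
    rw [← ofReal_integral_eq_lintegral_ofReal (f := fun ω => |Xs k ω - X ω|) (hdi k).abs
      (ae_of_all _ fun ω => abs_nonneg _)]
    refine ENNReal.ofReal_le_ofReal ?_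
    have h1 : ∫ ω, |Xs k ω - X ω| ∂P ≤ ∫ ω, (|Xs k ω| + |X ω|) ∂P :=
      integral_mono (hdi k).abs ((hKint _ (hXs k)).abs.add hXi.abs) fun ω => abs_sub _ _
    rw [integral_add (hKint _ (hXs k)).abs hXi.abs] at h1
    have h2 := hC _ (hXs k)
    have h3 := hC _ (hSK hX)
    linarith
  have hsum := tendsto_tsum_ennreal_of_dominated
    (F := fun k m => ENNReal.ofReal ((1 / 2) ^ m) *
      ∫⁻ ω in B m, ENNReal.ofReal |Xs k ω - X ω| ∂P)
    (b := fun m => ENNReal.ofReal ((1 / 2) ^ m) * ENNReal.ofReal (2 * C))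
    (by
      rw [ENNReal.tsum_mul_right]
      exact ENNReal.mul_ne_top summable_geometric_two.tsum_ofReal_ne_top ENNReal.ofReal_ne_top)
    (fun k m => mul_le_mul_right (hbound k m) _)
    (fun m => by
      have := ENNReal.Tendsto.const_mul (a := ENNReal.ofReal ((1 / 2) ^ m)) (hpiece m)
        (Or.inr ENNReal.ofReal_ne_top)
      rwa [mul_zero] at this)
  simp only [hQint]
  have := ENNReal.Tendsto.const_mul hsum (Or.inr hc)
  rwa [mul_zero] at this

/-- Theorem 3.2: uniform local convex-solidity of the relative `L⁰(P)`-topology on `S` is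
equivalent to the existence of an equivalent measure `Q` turning convergence in probability
to limits in `S` into `L¹(Q)`-convergence. -/
theorem statement5 (P : Measure Ω) [IsProbabilityMeasure P]
    (K S : Set (Ω → ℝ)) (hKconv : Convex ℝ K) (hKbdd : BddL1 P K)
    (hS : S.Nonempty) (hSsub : S ⊆ K) :
    UnifLCS P K S ↔
      (∃ Q : Measure Ω, EquivProb P Q ∧
        ∀ (Xs : ℕ → Ω → ℝ) (X : Ω → ℝ), (∀ n, Xs n ∈ K) → X ∈ S →
          TendstoInMeasure P Xs atTop X →
          Tendsto (fun n => ∫⁻ ω, ENNReal.ofReal |Xs n ω - X ω| ∂Q) atTop (nhds 0)) := by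
  exact ⟨exists_equivProb_of_unifLCS hKbdd hS hSsub, fun ⟨_, hQ, hconv⟩ =>
    unifLCS_of_equivProb hKbdd.1 hSsub hQ hconv⟩

end Paper
end
end

section
/- Let (Ω,Σ,P) be a probability space, let (X_n) be a sequence of nonnegative random variables and let X be a nonnegative random variable. Suppose that every forward convex combination of (X_n) converges to X in P-probability. Then every forward convex combination of the sequence (|X_n − X|) converges to 0 in P-probability. -/
open MeasureTheory Filter Set ProbabilityTheory

noncomputable section

namespace Paper

variable {Ω : Type*} [MeasurableSpace Ω]

/-- Dominated convergence in measure: a sequence tending to `0` in measure and dominated by an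
integrable function tends to `0` in `L¹`. -/
lemma tendsto_eLpNorm_one_zero_of_dominated {P : Measure Ω} {f : ℕ → Ω → ℝ} {g : Ω → ℝ}
    (hf : ∀ n, AEStronglyMeasurable (f n) P) (hg : Integrable g P)
    (hfg : ∀ n, ∀ᵐ ω ∂P, |f n ω| ≤ g ω)
    (h : TendstoInMeasure P f atTop (fun _ => (0 : ℝ))) :
    Tendsto (fun n => eLpNorm (f n) 1 P) atTop (nhds 0) := by
  refine tendsto_of_subseq_tendsto fun ns hns => ?_
  obtain ⟨ms, -, hms⟩ := (h.comp hns).exists_seq_tendsto_ae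
  refine ⟨ms, ?_⟩
  simp only [eLpNorm_one_eq_lintegral_enorm]
  rw [← lintegral_zero (μ := P)]
  refine tendsto_lintegral_of_dominated_convergence' (fun ω => ‖g ω‖ₑ)
    (fun n => (hf _).enorm) (fun n => ?_) hg.2.ne ?_
  · filter_upwards [hfg (ns (ms n))] with ω hω
    exact enorm_le_iff_norm_le.2 (hω.trans (le_abs_self _))
  · filter_upwards [hms] with ω hω
    simpa [Function.comp_def] using (continuous_enorm.tendsto (0 : ℝ)).comp hω

/-- Weighted `L¹`-balls are convex. -/
lemma convex_setOf_eLpNorm_mul_le (P : Measure Ω) (ρ : Ω → ℝ)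
    (hρ : AEStronglyMeasurable ρ P) (d : ENNReal) :
    Convex ℝ {u : Ω → ℝ | AEStronglyMeasurable u P ∧ eLpNorm (ρ * u) 1 P ≤ d} := by
  rintro u ⟨hu, hud⟩ v ⟨hv, hvd⟩ a b ha hb hab
  refine ⟨(hu.const_smul a).add (hv.const_smul b), ?_⟩
  have hsplit : ρ * (a • u + b • v) = a • (ρ * u) + b • (ρ * v) := by
    rw [mul_add, mul_smul_comm, mul_smul_comm]
  calc eLpNorm (ρ * (a • u + b • v)) 1 P
      ≤ eLpNorm (a • (ρ * u)) 1 P + eLpNorm (b • (ρ * v)) 1 P := by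
        rw [hsplit]
        exact eLpNorm_add_le ((hρ.mul hu).const_smul a) ((hρ.mul hv).const_smul b) le_rfl
    _ = ENNReal.ofReal a * eLpNorm (ρ * u) 1 P + ENNReal.ofReal b * eLpNorm (ρ * v) 1 P := by
        rw [eLpNorm_const_smul, eLpNorm_const_smul, Real.enorm_of_nonneg ha,
          Real.enorm_of_nonneg hb]
    _ ≤ ENNReal.ofReal a * d + ENNReal.ofReal b * d := by gcongr
    _ = d := by
        rw [← add_mul, ← ENNReal.ofReal_add ha hb, hab, ENNReal.ofReal_one, one_mul]

/-- Multiplying by a fixed function preserves convergence to `0` in measure. -/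
lemma TendstoInMeasure.mul_left_zero {P : Measure Ω} [IsFiniteMeasure P] {f : ℕ → Ω → ℝ}
    {ρ : Ω → ℝ} (hf : ∀ n, AEStronglyMeasurable (f n) P) (hρ : AEStronglyMeasurable ρ P)
    (h : TendstoInMeasure P f atTop (fun _ => (0 : ℝ))) :
    TendstoInMeasure P (fun n => ρ * f n) atTop (fun _ => (0 : ℝ)) := by
  refine (exists_seq_tendstoInMeasure_atTop_iff fun n => hρ.mul (hf n)).2 fun ns hns => ?_
  obtain ⟨ms, hms, hlim⟩ := (exists_seq_tendstoInMeasure_atTop_iff hf).1 h ns hns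
  refine ⟨ms, hms, ?_⟩
  filter_upwards [hlim] with ω hω
  simpa using hω.const_mul (ρ ω)

/-- If a sequence tends to `0` in measure and is dominated by a single random variable, then so
do all of its forward convex combinations. -/
lemma IsFCC.tendstoInMeasure_zero_of_dominated {P : Measure Ω} [IsFiniteMeasure P]
    {U V : ℕ → Ω → ℝ} {G : Ω → ℝ} (hV : IsFCC U V)
    (hU : ∀ n, AEStronglyMeasurable (U n) P) (hG : AEStronglyMeasurable G P)
    (hUG : ∀ n, ∀ᵐ ω ∂P, |U n ω| ≤ |G ω|)
    (h : TendstoInMeasure P U atTop (fun _ => (0 : ℝ))) :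
    (∀ n, AEStronglyMeasurable (V n) P) ∧
      TendstoInMeasure P V atTop (fun _ => (0 : ℝ)) := by
  set τ : Ω → ℝ := fun ω => 1 + |G ω| with hτdef
  set ρ : Ω → ℝ := fun ω => (1 + |G ω|)⁻¹ with hρdef
  have hτ : AEStronglyMeasurable τ P := aestronglyMeasurable_const.add hG.norm
  have hρ : AEStronglyMeasurable ρ P := hτ.aemeasurable.inv.aestronglyMeasurable
  have hpos : ∀ ω, 0 < 1 + |G ω| := fun ω => by positivity
  have hlim : Tendsto (fun n => eLpNorm (ρ * U n) 1 P) atTop (nhds 0) := by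
    refine tendsto_eLpNorm_one_zero_of_dominated (fun n => hρ.mul (hU n))
      (integrable_const (1 : ℝ)) (fun n => ?_) (TendstoInMeasure.mul_left_zero hU hρ h)
    filter_upwards [hUG n] with ω hω
    rw [Pi.mul_apply, abs_mul, hρdef, abs_of_pos (inv_pos.2 (hpos ω)),
      inv_mul_le_one₀ (hpos ω)]
    linarith
  set d : ℕ → ENNReal := fun k => ⨆ n ≥ k, eLpNorm (ρ * U n) 1 P with hd
  have hd0 : Tendsto d atTop (nhds 0) := by
    rw [ENNReal.tendsto_nhds_zero] at hlim ⊢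
    intro ε hε
    obtain ⟨N, hN⟩ := eventually_atTop.1 (hlim ε hε)
    exact eventually_atTop.2 ⟨N, fun k hk => iSup₂_le fun n hn => hN n (hk.trans hn)⟩
  have hmem : ∀ k, AEStronglyMeasurable (V k) P ∧ eLpNorm (ρ * V k) 1 P ≤ d k := by
    intro k
    refine convexHull_min ?_ (convex_setOf_eLpNorm_mul_le P ρ hρ (d k)) (hV k)
    rintro _ ⟨n, hn, rfl⟩
    exact ⟨hU n, le_iSup₂ (f := fun n (_ : n ≥ k) => eLpNorm (ρ * U n) 1 P) n hn⟩
  refine ⟨fun k => (hmem k).1, ?_⟩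
  have hρV : TendstoInMeasure P (fun k => ρ * V k) atTop (fun _ => (0 : ℝ)) := by
    refine tendstoInMeasure_of_tendsto_eLpNorm one_ne_zero (fun k => hρ.mul (hmem k).1)
      aestronglyMeasurable_const ?_
    refine tendsto_of_tendsto_of_tendsto_of_le_of_le tendsto_const_nhds hd0
      (fun _ => zero_le) fun k => ?_
    have hsub : (ρ * V k - fun _ => (0 : ℝ)) = ρ * V k := by ext ω; simp
    simpa only [hsub] using (hmem k).2
  have hcancel : (fun k => τ * (ρ * V k)) = V := by
    ext k ω
    simp only [Pi.mul_apply, hτdef, hρdef]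
    rw [mul_inv_cancel_left₀ (hpos ω).ne']
  rw [← hcancel]
  exact TendstoInMeasure.mul_left_zero (fun k => hρ.mul (hmem k).1) hτ hρV

/-- A forward convex combination of `(|X_n - X|)` is the sum of a forward convex combination of
`(X_n - X)` and twice one of the negative parts `((X - X_n)⁺)`. -/
lemma IsFCC.exists_eq_sub_add_two_mul {α : Type*} {Xs W : ℕ → α → ℝ} {X : α → ℝ}
    (hW : IsFCC (fun n ω => |Xs n ω - X ω|) W) :
    ∃ V U : ℕ → α → ℝ, IsFCC Xs V ∧ IsFCC (fun n ω => max (X ω - Xs n ω) 0) U ∧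
      ∀ k ω, W k ω = V k ω - X ω + 2 * U k ω := by
  have key : ∀ k, ∃ v ∈ convexHull ℝ (Xs '' {n | k ≤ n}),
      ∃ u ∈ convexHull ℝ ((fun n ω => max (X ω - Xs n ω) 0) '' {n | k ≤ n}),
        ∀ ω, W k ω = v ω - X ω + 2 * u ω := by
    intro k
    set A := convexHull ℝ (Xs '' {n | k ≤ n})
    set B := convexHull ℝ ((fun n ω => max (X ω - Xs n ω) 0) '' {n | k ≤ n})
    have hconv : Convex ℝ
        {w : α → ℝ | ∃ v ∈ A, ∃ u ∈ B, ∀ ω, w ω = v ω - X ω + 2 * u ω} := by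
      rintro w ⟨v, hv, u, hu, hw⟩ w' ⟨v', hv', u', hu', hw'⟩ a b ha hb hab
      refine ⟨a • v + b • v', convex_convexHull ℝ _ hv hv' ha hb hab,
        a • u + b • u', convex_convexHull ℝ _ hu hu' ha hb hab, fun ω => ?_⟩
      simp only [Pi.add_apply, Pi.smul_apply, smul_eq_mul, hw, hw']
      linear_combination (-X ω) * hab
    refine convexHull_min ?_ hconv (hW k)
    rintro _ ⟨n, hn, rfl⟩
    refine ⟨Xs n, subset_convexHull ℝ _ ⟨n, hn, rfl⟩, _,
      subset_convexHull ℝ _ ⟨n, hn, rfl⟩, fun ω => ?_⟩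
    rcases le_total (X ω) (Xs n ω) with h | h
    · simp only [abs_of_nonneg (sub_nonneg.2 h), max_eq_right (sub_nonpos.2 h)]
      ring
    · simp only [abs_of_nonpos (sub_nonpos.2 h), max_eq_left (sub_nonneg.2 h)]
      ring
  choose V hV U hU h using key
  exact ⟨V, U, hV, hU, h⟩

/-- Forward convex combinations of measurable functions are measurable. -/
lemma IsFCC.aestronglyMeasurable {P : Measure Ω} {Xs V : ℕ → Ω → ℝ} (hV : IsFCC Xs V)
    (hXs : ∀ n, AEStronglyMeasurable (Xs n) P) (k : ℕ) : AEStronglyMeasurable (V k) P := by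
  have hconv : Convex ℝ {v : Ω → ℝ | AEStronglyMeasurable v P} :=
    fun _ hu _ hv a b _ _ _ => (hu.const_smul a).add (hv.const_smul b)
  refine convexHull_min ?_ hconv (hV k)
  rintro _ ⟨n, -, rfl⟩
  exact hXs n

/-- Lemma 3.5 (Kardaras–Žitković, Lemma 2.4): if every forward convex combination of the
nonnegative sequence `(X_n)` converges to `X` in probability, then every forward convex
combination of `(|X_n - X|)` converges to `0` in probability. -/
theorem statement7 (P : Measure Ω) [IsProbabilityMeasure P]
    (Xs : ℕ → Ω → ℝ) (X : Ω → ℝ)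
    (hXsmeas : ∀ n, AEStronglyMeasurable (Xs n) P) (hXmeas : AEStronglyMeasurable X P)
    (hXspos : ∀ n, (0 : Ω → ℝ) ≤ᵐ[P] Xs n) (hXpos : (0 : Ω → ℝ) ≤ᵐ[P] X)
    (hfcc : ∀ W : ℕ → Ω → ℝ, IsFCC Xs W → TendstoInMeasure P W atTop X) :
    ∀ W : ℕ → Ω → ℝ, IsFCC (fun n ω => |Xs n ω - X ω|) W →
      TendstoInMeasure P W atTop (fun _ => (0 : ℝ)) := by
  intro W hW
  obtain ⟨V, U, hV, hU, hWVU⟩ := hW.exists_eq_sub_add_two_mul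
  have hXs : TendstoInMeasure P Xs atTop X :=
    hfcc Xs fun k => subset_convexHull ℝ _ ⟨k, le_refl k, rfl⟩
  have hNmeas : ∀ n, AEStronglyMeasurable (fun ω => max (X ω - Xs n ω) 0) P := fun n =>
    (hXmeas.sub (hXsmeas n)).sup aestronglyMeasurable_const
  have hN : TendstoInMeasure P (fun n ω => max (X ω - Xs n ω) 0) atTop (fun _ => (0 : ℝ)) := by
    refine (exists_seq_tendstoInMeasure_atTop_iff hNmeas).2 fun ns hns => ?_
    obtain ⟨ms, hms, hlim⟩ := (exists_seq_tendstoInMeasure_atTop_iff hXsmeas).1 hXs ns hns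
    refine ⟨ms, hms, ?_⟩
    filter_upwards [hlim] with ω hω
    simpa using (hω.const_sub (X ω)).max (tendsto_const_nhds (x := (0 : ℝ)))
  have hNX : ∀ n, ∀ᵐ ω ∂P, |max (X ω - Xs n ω) 0| ≤ |X ω| := by
    intro n
    filter_upwards [hXspos n] with ω hω
    have h0 : 0 ≤ Xs n ω := hω
    rw [abs_of_nonneg (le_max_right _ _)]
    exact max_le (by linarith [le_abs_self (X ω)]) (abs_nonneg _)
  obtain ⟨hUmeas, hUlim⟩ := hU.tendstoInMeasure_zero_of_dominated hNmeas hXmeas hNX hN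
  have hVmeas := hV.aestronglyMeasurable hXsmeas
  have hW_eq : W = fun k ω => V k ω - X ω + 2 * U k ω := by
    ext k ω
    exact hWVU k ω
  rw [hW_eq]
  refine (exists_seq_tendstoInMeasure_atTop_iff fun k =>
    ((hVmeas k).sub hXmeas).add ((hUmeas k).const_mul 2)).2 fun ns hns => ?_
  obtain ⟨ms, hms, hVae⟩ := (exists_seq_tendstoInMeasure_atTop_iff hVmeas).1 (hfcc V hV) ns hns
  obtain ⟨ls, hls, hUae⟩ :=
    (exists_seq_tendstoInMeasure_atTop_iff hUmeas).1 hUlim (ns ∘ ms) (hns.comp hms)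
  refine ⟨ms ∘ ls, hms.comp hls, ?_⟩
  filter_upwards [hVae, hUae] with ω hVω hUω
  simpa using ((hVω.comp hls.tendsto_atTop).sub_const (X ω)).add (hUω.const_mul 2)

end Paper
end
end
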